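/- Let p be a prime and G a finite soluble group such that for every prime q ≠ p every Sylow q-subgroup of G is either cyclic or a generalized quaternion group. Then the Fitting height of G is at most 4, i.e. there is a chain of normal subgroups 1 = G₀ ≤ G₁ ≤ G₂ ≤ G₃ ≤ G₄ = G of G with each quotient G_{i+1}/G_i nilpotent. -/

import Mathlib

/-- A topological group is *pronilpotent* if its quotient by every open normal
subgroup is nilpotent. -/
def IsPronilpotent (G : Type*) [Group G] [TopologicalSpace G] : Prop :=
  ∀ (N : Subgroup G) (hN : N.Normal), IsOpen (N : Set G) →
    haveI := hN
    Group.IsNilpotent (G ⧸ N)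

/-- A topological group is a *CN-group* if the centralizer of every nontrivial
element is pronilpotent. -/
def IsCN (G : Type*) [Group G] [TopologicalSpace G] : Prop :=
  ∀ x : G, x ≠ 1 → IsPronilpotent ↥(Subgroup.centralizer {x})

/-- A topological group is *pro-π* (for a set of naturals π) if every prime dividing
the order of a quotient by an open normal subgroup lies in π. -/
def IsProPi (π : Set ℕ) (G : Type*) [Group G] [TopologicalSpace G] : Prop :=
  ∀ N : Subgroup G, N.Normal → IsOpen (N : Set G) →
    ∀ p : ℕ, p.Prime → p ∣ Nat.card (G ⧸ N) → p ∈ π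

/-- π(G): the set of primes dividing the order of some quotient of G by an
open normal subgroup. -/
def primesOf (G : Type*) [Group G] [TopologicalSpace G] : Set ℕ :=
  {p | p.Prime ∧ ∃ N : Subgroup G, N.Normal ∧ IsOpen (N : Set G) ∧ p ∣ Nat.card (G ⧸ N)}

/-- A topological group is *prosoluble* if its quotient by every open normal
subgroup is soluble. -/
def IsProsoluble (G : Type*) [Group G] [TopologicalSpace G] : Prop :=
  ∀ (N : Subgroup G) (hN : N.Normal), IsOpen (N : Set G) →
    haveI := hN
    IsSolvable (G ⧸ N)

/-- A group is generalized quaternion if it is isomorphic to `Q_{2^n}` for some `n ≥ 3`;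
here `QuaternionGroup m` is the dicyclic group of order `4m`, so `Q_{2^n}` is
`QuaternionGroup (2 ^ (n - 2))`. -/
def IsGeneralizedQuaternion (G : Type*) [Group G] : Prop :=
  ∃ n : ℕ, 3 ≤ n ∧ Nonempty (G ≃* QuaternionGroup (2 ^ (n - 2)))

/-- `X` is a Frobenius group with kernel `K` and complement `H`. -/
def IsFrobeniusWith {X : Type*} [Group X] (K H : Subgroup X) : Prop :=
  K.Normal ∧ K ≠ ⊥ ∧ K ≠ ⊤ ∧ H ≠ ⊥ ∧ K ⊔ H = ⊤ ∧ K ⊓ H = ⊥ ∧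
    ∀ g : X, g ∉ H → ∀ x : X, x ∈ H → g * x * g⁻¹ ∈ H → x = 1

/-- `X` is a Frobenius group. -/
def IsFrobenius (X : Type*) [Group X] : Prop :=
  ∃ K H : Subgroup X, IsFrobeniusWith K H

/-- `X` is almost simple: it has a non-abelian simple normal subgroup with trivial
centralizer. -/
def IsAlmostSimple (X : Type*) [Group X] : Prop :=
  ∃ S : Subgroup X, S.Normal ∧ IsSimpleGroup ↥S ∧ (∃ a b : ↥S, a * b ≠ b * a) ∧
    Subgroup.centralizer (S : Set X) = ⊥

/-- The quotient `B/A` (for subgroups `A ≤ B`) is nilpotent. -/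
def IsNilpotentQuotient {G : Type*} [Group G] (A B : Subgroup G) : Prop :=
  ∃ h : (A.subgroupOf B).Normal,
    haveI := h
    Group.IsNilpotent (↥B ⧸ A.subgroupOf B)

/-- The quotient `B/A` (for subgroups `A ≤ B` of a topological group) is pronilpotent. -/
def IsPronilpotentQuotient {G : Type*} [Group G] [TopologicalSpace G] (A B : Subgroup G) : Prop :=
  ∃ h : (A.subgroupOf B).Normal,
    haveI := h
    IsPronilpotent (↥B ⧸ A.subgroupOf B)

section Conjugation

open Subgroup

variable {H : Type*} [Group H]

/-- A commutator `⁅K, L⁆` centralizes a normal subgroup on which conjugation by elements of `K`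
commutes with conjugation by elements of `L`. -/
theorem commutator_le_centralizer_of_conj_comm {R K L : Subgroup H} [R.Normal]
    (h : ∀ g ∈ K, ∀ k ∈ L, ∀ r ∈ R, g * (k * r * k⁻¹) * g⁻¹ = k * (g * r * g⁻¹) * k⁻¹) :
    ⁅K, L⁆ ≤ centralizer (R : Set H) := by
  rw [commutator_le]
  intro g hg k hk
  rw [mem_centralizer_iff]
  intro r hr
  have hn : (k * g)⁻¹ * r * (k * g) ∈ R := by
    simpa using (inferInstance : R.Normal).conj_mem r hr (k * g)⁻¹
  have := h g hg k hk _ hn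
  have e : k * (g * ((k * g)⁻¹ * r * (k * g)) * g⁻¹) * k⁻¹ = r := by group
  rw [e] at this
  rw [commutatorElement_def]
  calc r * (g * k * g⁻¹ * k⁻¹)
      = (g * (k * ((k * g)⁻¹ * r * (k * g)) * k⁻¹) * g⁻¹) * (g * k * g⁻¹ * k⁻¹) := by rw [this]
    _ = g * k * g⁻¹ * k⁻¹ * r := by group

/-- The derived subgroup centralizes every cyclic normal subgroup. -/
theorem commutator_le_centralizer_of_isCyclic (R : Subgroup H) [R.Normal] [IsCyclic R] :
    commutator H ≤ centralizer (R : Set H) := by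
  refine commutator_le_centralizer_of_conj_comm fun g _ k _ r hr => ?_
  have key : ∀ g : H, ∃ m : ℤ, ∀ r ∈ R, g * r * g⁻¹ = r ^ m := fun g => by
    obtain ⟨m, hm⟩ := MonoidHom.map_cyclic (MulAut.conjNormal g : R ≃* R).toMonoidHom
    exact ⟨m, fun r hr => by simpa using congrArg Subtype.val (hm ⟨r, hr⟩)⟩
  obtain ⟨m, hm⟩ := key g
  obtain ⟨n, hn⟩ := key k
  rw [hn r hr, hm r hr, hm _ (zpow_mem hr n), hn _ (zpow_mem hr m), zpow_comm]

theorem derivedSeries_perm_two_eq_bot (α : Type*) [Finite α] (hα : Nat.card α ≤ 3) :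
    derivedSeries (Equiv.Perm α) 2 = ⊥ := by
  have key : ∀ n ≤ 3, ∀ a b : Equiv.Perm (Fin n), a.sign = 1 → b.sign = 1 → a * b = b * a := by
    intro n hn
    interval_cases n <;> decide
  let e : α ≃ Fin (Nat.card α) := Finite.equivFin α
  let s : Equiv.Perm α →* ℤˣ := Equiv.Perm.sign.comp e.permCongrHom.toMonoidHom
  have hs : derivedSeries (Equiv.Perm α) 1 ≤ s.ker := Abelianization.commutator_subset_ker s
  rw [derivedSeries_succ, commutator_eq_bot_iff_le_centralizer]
  intro a ha
  rw [mem_centralizer_iff]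
  intro b hb
  exact e.permCongrHom.injective (by simpa using key _ hα _ _ (hs hb) (hs ha))

/-- The second derived subgroup centralizes every normal subgroup of order at most four. -/
theorem derivedSeries_two_le_centralizer_of_card_le_four (R : Subgroup H) [R.Normal] [Finite R]
    (hR : Nat.card R ≤ 4) : derivedSeries H 2 ≤ centralizer (R : Set H) := by
  let f : H →* Equiv.Perm {r : R // r ≠ 1} :=
    { toFun := fun h => (MulAut.conjNormal h : R ≃* R).toEquiv.subtypeEquiv (by simp)
      map_one' := by ext; simp
      map_mul' := fun a b => by ext; simp [mul_assoc] }
  have hc : Nat.card {r : R // r ≠ 1} ≤ 3 := by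
    have := Fintype.ofFinite R
    classical
    rw [Nat.card_eq_fintype_card] at hR ⊢
    rw [Fintype.card_subtype_compl, Fintype.card_subtype_eq]
    omega
  intro h hh
  have hf : f h = 1 := by
    have := map_derivedSeries_le_derivedSeries f 2 (mem_map_of_mem f hh)
    rwa [derivedSeries_perm_two_eq_bot _ hc, mem_bot] at this
  rw [mem_centralizer_iff]
  intro r hr
  by_cases h1 : r = 1
  · simp [h1]
  · have := congrArg (fun x => ((x.1 : R) : H))
      (Equiv.congr_fun hf ⟨⟨r, hr⟩, by simpa [Subtype.ext_iff] using h1⟩)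
    have h2 : h * r * h⁻¹ = r := by simpa [f] using this
    rw [mul_inv_eq_iff_eq_mul] at h2
    exact h2.symm

end Conjugation

section Fitting

open Subgroup

variable {H : Type*} [Group H]

/-- In a soluble group, a normal subgroup containing all nilpotent normal subgroups contains its
own centralizer. -/
theorem centralizer_le_of_forall_isNilpotent_le [Group.IsSolvable H] (F : Subgroup H) [F.Normal]
    (hF : ∀ A : Subgroup H, A.Normal → Group.IsNilpotent A → A ≤ F) :
    centralizer (F : Set H) ≤ F := by
  set C := centralizer (F : Set H)
  obtain ⟨n, hn⟩ := Group.IsSolvable.solvable (G := H)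
  have key : ∀ k ≤ n, derivedSeries H (n - k) ⊓ C ≤ F := by
    intro k
    induction k with
    | zero => intro _; simp [hn]
    | succ k ih =>
      intro hk
      set E := derivedSeries H (n - (k + 1)) ⊓ C
      have hE : ⁅E, E⁆ ≤ F := by
        refine le_trans (le_inf ?_ ?_) (ih (by omega))
        · rw [show n - k = (n - (k + 1)) + 1 by omega, derivedSeries_succ]
          exact commutator_mono inf_le_left inf_le_left
        · exact (commutator_mono inf_le_right inf_le_right).trans (commutator_le_self C)
      refine hF E inferInstance (isNilpotent_of_lowerCentralSeries_eq_bot (n := 2) ?_)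
      rw [Subgroup.lowerCentralSeries_succ, Subgroup.lowerCentralSeries_succ,
        Subgroup.lowerCentralSeries_zero, eq_bot_iff]
      refine (commutator_mono hE inf_le_right).trans ?_
      rw [commutator_comm, le_bot_iff, commutator_eq_bot_iff_le_centralizer]
  simpa using key n le_rfl

/-- The largest normal `q`-subgroup of a finite group. -/
noncomputable def largestNormalPSubgroup (H : Type*) [Group H] (q : ℕ) : Subgroup H :=
  (default : Sylow q H).toSubgroup.normalCore

instance (q : ℕ) : (largestNormalPSubgroup H q).Normal := normalCore_normal _

theorem isPGroup_largestNormalPSubgroup (q : ℕ) : IsPGroup q (largestNormalPSubgroup H q) :=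
  (default : Sylow q H).isPGroup'.to_le (normalCore_le _)

theorem IsPGroup.le_largestNormalPSubgroup {q : ℕ} {A : Subgroup H} [A.Normal]
    (hA : IsPGroup q A) : A ≤ largestNormalPSubgroup H q :=
  normal_le_normalCore.mpr (hA.le_sylow_of_normal _)

/-- The Fitting subgroup of a finite group, as the join of its largest normal `q`-subgroups. -/
noncomputable def fittingSubgroup (H : Type*) [Group H] : Subgroup H :=
  ⨆ q : (Nat.card H).primeFactors, largestNormalPSubgroup H q

instance : (fittingSubgroup H).Normal := by
  unfold fittingSubgroup; infer_instance

theorem commute_of_mem_largestNormalPSubgroup {p q : ℕ} (hp : p.Prime) (hq : q.Prime)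
    (hpq : p ≠ q) {x y : H} (hx : x ∈ largestNormalPSubgroup H p)
    (hy : y ∈ largestNormalPSubgroup H q) : Commute x y := by
  have := Fact.mk hp
  have := Fact.mk hq
  exact commute_of_normal_of_disjoint _ _ inferInstance inferInstance
    (IsPGroup.disjoint_of_ne p q hpq _ _ (isPGroup_largestNormalPSubgroup p)
      (isPGroup_largestNormalPSubgroup q)) x y hx hy

variable [Finite H]

instance isNilpotent_fittingSubgroup : Group.IsNilpotent (fittingSubgroup H) := by
  have hcomm : Pairwise fun p q : (Nat.card H).primeFactors => ∀ x y : H,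
      x ∈ largestNormalPSubgroup H p → y ∈ largestNormalPSubgroup H q → Commute x y :=
    fun p q hpq x y => commute_of_mem_largestNormalPSubgroup (Nat.prime_of_mem_primeFactors p.2)
      (Nat.prime_of_mem_primeFactors q.2) (fun h => hpq (Subtype.ext h))
  have : ∀ q : (Nat.card H).primeFactors, Group.IsNilpotent (largestNormalPSubgroup H q) :=
    fun q => by
      have := Fact.mk (Nat.prime_of_mem_primeFactors q.2)
      exact (isPGroup_largestNormalPSubgroup (H := H) (q : ℕ)).isNilpotent
  unfold fittingSubgroup
  rw [← noncommPiCoprod_range (hcomm := hcomm)]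
  exact Group.nilpotent_of_surjective _ (MonoidHom.rangeRestrict_surjective _)

theorem le_fittingSubgroup (A : Subgroup H) [A.Normal] [Group.IsNilpotent A] :
    A ≤ fittingSubgroup H := by
  rw [← subgroupOf_eq_top, ← index_eq_one]
  by_contra hne
  obtain ⟨q, hq, hdvd⟩ := Nat.exists_prime_and_dvd hne
  have := Fact.mk hq
  let P : Sylow q A := default
  have : P.Characteristic := P.characteristic_of_normal inferInstance
  have hP : (P.toSubgroup.map A.subtype) ≤ fittingSubgroup H := by
    have hqH : q ∈ (Nat.card H).primeFactors :=
      Nat.mem_primeFactors.mpr ⟨hq, hdvd.trans ((index_dvd_card _).trans (card_subgroup_dvd_card A)),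
        Nat.card_pos.ne'⟩
    refine (IsPGroup.le_largestNormalPSubgroup (P.isPGroup'.map A.subtype)).trans ?_
    exact le_iSup (fun q : (Nat.card H).primeFactors => largestNormalPSubgroup H q) ⟨q, hqH⟩
  refine P.not_dvd_index (hdvd.trans (index_dvd_of_le ?_))
  rwa [subgroupOf, ← map_le_iff_le_comap]

theorem centralizer_fittingSubgroup_le [Group.IsSolvable H] :
    centralizer (fittingSubgroup H : Set H) ≤ fittingSubgroup H :=
  centralizer_le_of_forall_isNilpotent_le _ fun A _ _ => le_fittingSubgroup A

end Fitting

section Quaternion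

open Subgroup

variable {H : Type*} [Group H]

theorem mem_sup_centralizer_of_conj_eq {R : Subgroup H} {h t : H} (ht : t ∈ R)
    (hr : ∀ r ∈ R, h * r * h⁻¹ = t * r * t⁻¹) : h ∈ R ⊔ centralizer (R : Set H) := by
  rw [← mul_inv_cancel_left t h]
  refine mul_mem (mem_sup_left ht) (mem_sup_right (mem_centralizer_iff.mpr fun r hrR => ?_))
  have h1 : h * r = t * r * t⁻¹ * h := by rw [← hr r hrR]; group
  calc r * (t⁻¹ * h) = t⁻¹ * (t * r * t⁻¹ * h) := by group
    _ = t⁻¹ * h * r := by rw [← h1, mul_assoc]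

/-- The second derived subgroup induces inner automorphisms on every normal subgroup which
is generated by a cyclic subgroup `⟨c⟩` and an element `y` of order four inverting `c`. -/
theorem derivedSeries_two_le_sup_centralizer_of_dicyclic {R : Subgroup H} [R.Normal] {c y : H}
    (hc : c ∈ R) (hy : y ∈ R)
    (hR : ∀ r ∈ R, r ∈ zpowers c ∨ ∃ a ∈ zpowers c, r = a * y)
    (hyc : y * c * y⁻¹ = c⁻¹) (hyn : y ∉ zpowers c) (hy2 : y ^ 2 ≠ 1) :
    derivedSeries H 2 ≤ R ⊔ centralizer (R : Set H) := by
  have hinv : ∀ a ∈ zpowers c, y * a * y⁻¹ = a⁻¹ := by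
    rintro _ ⟨k, rfl⟩
    simp only [← conj_zpow, hyc, inv_zpow]
  have hsq : ∀ a ∈ zpowers c, (a * y) ^ 2 = y ^ 2 := fun a ha => by
    calc (a * y) ^ 2 = a * (y * a * y⁻¹) * y ^ 2 := by simp only [pow_two]; group
      _ = y ^ 2 := by rw [hinv a ha]; group
  have hy2c : y ^ 2 ∈ zpowers c := by
    refine (hR _ (pow_mem hy 2)).resolve_right ?_
    rintro ⟨a, ha, h⟩
    rw [pow_two, mul_right_cancel_iff] at h
    exact hyn (h ▸ ha)
  have hy4 : (y ^ 2) ^ 2 = 1 := by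
    have h1 := hinv _ hy2c
    rw [show y * y ^ 2 * y⁻¹ = y ^ 2 by group, eq_inv_iff_mul_eq_one] at h1
    rw [pow_two (y ^ 2), h1]
  have hout : ∀ r ∈ R, r ∉ zpowers c → r ^ 2 = y ^ 2 := fun r hr hrc => by
    obtain ⟨a, ha, rfl⟩ := (hR r hr).resolve_left hrc
    exact hsq a ha
  have hconj : ∀ h r : H, r ∈ R → h * r * h⁻¹ ∈ R :=
    fun h r hr => (inferInstance : R.Normal).conj_mem r hr h
  by_cases h4 : c ^ 4 = 1 ∧ c ^ 2 ≠ 1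
  · obtain ⟨h4, h2⟩ := h4
    have hinvol : ∀ a ∈ zpowers c, a ^ 2 = 1 → a ≠ 1 → a = c ^ 2 := by
      have : IsOfFinOrder c := isOfFinOrder_iff_pow_eq_one.mpr ⟨4, by norm_num, h4⟩
      intro a ha ha2 ha1
      obtain ⟨k, rfl⟩ := (this.mem_powers_iff_mem_zpowers).mpr ha
      have ho : orderOf c = 2 ^ (1 + 1) :=
        orderOf_eq_prime_pow (by simpa using h2) (by simpa using h4)
      simp only [← pow_mul, ← orderOf_dvd_iff_pow_eq_one, ho] at ha2
      simp only [ne_eq, ← orderOf_dvd_iff_pow_eq_one, ho] at ha1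
      simp only [pow_eq_pow_iff_modEq, ho]
      change k % _ = 2 % _
      omega
    have hzc : ∀ h : H, h * c ^ 2 * h⁻¹ = c ^ 2 := by
      intro h
      have hs : (h * c ^ 2 * h⁻¹) ^ 2 = 1 := by
        rw [conj_pow, ← pow_mul, h4]; group
      refine hinvol _ ?_ hs ?_
      · by_contra hn
        exact hy2 ((hout _ (hconj h _ (pow_mem hc 2)) hn).symm.trans hs)
      · simpa [mul_inv_eq_one] using h2
    let Z : Subgroup H := zpowers (c ^ 2)
    have hZ : ∀ z ∈ Z, z = 1 ∨ z = c ^ 2 := by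
      rintro _ ⟨k, rfl⟩
      obtain ⟨j, rfl | rfl⟩ := Int.even_or_odd' k
      · left; simp only [zpow_mul]; norm_cast; rw [← pow_mul, h4, one_zpow]
      · right; simp only [zpow_add, zpow_mul]; norm_cast; rw [← pow_mul, h4, one_zpow]; simp
    have hZn : Z.Normal := by
      refine ⟨fun z hz h => ?_⟩
      obtain rfl | rfl := hZ z hz
      · simp [Z]
      · rw [hzc]; exact hz
    have hcard : (R.map (QuotientGroup.mk' Z) : Set (H ⧸ Z)) ⊆
        ({1, (c : H ⧸ Z), (y : H ⧸ Z), (c : H ⧸ Z) * y} : Set (H ⧸ Z)) := by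
      have hcZ : ((c : H ⧸ Z)) ^ 2 = 1 := by
        rw [← QuotientGroup.mk_pow, QuotientGroup.eq_one_iff]; exact mem_zpowers _
      have hca : ∀ a ∈ zpowers c, (a : H ⧸ Z) = 1 ∨ (a : H ⧸ Z) = c := by
        rintro _ ⟨k, rfl⟩
        obtain ⟨j, rfl | rfl⟩ := Int.even_or_odd' k
        · left; simp only [QuotientGroup.mk_zpow, zpow_mul]; norm_cast; simp [hcZ]
        · right; simp only [zpow_mul, zpow_add]; norm_cast; simp [hcZ]
      rintro _ ⟨r, hr, rfl⟩
      obtain ha | ⟨a, ha, rfl⟩ := hR r hr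
      · obtain h | h := hca _ ha <;> simp [h]
      · obtain h | h := hca _ ha <;> simp [h]
    have hfin : ({1, (c : H ⧸ Z), (y : H ⧸ Z), (c : H ⧸ Z) * y} : Set (H ⧸ Z)).Finite := by simp
    have : Finite (R.map (QuotientGroup.mk' Z)) := hfin.subset hcard
    have : (R.map (QuotientGroup.mk' Z)).Normal :=
      Normal.map inferInstance _ (QuotientGroup.mk'_surjective Z)
    have hle := derivedSeries_two_le_centralizer_of_card_le_four (R.map (QuotientGroup.mk' Z)) <| by
      rw [← SetLike.coe_sort_coe, Nat.card_coe_set_eq]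
      refine (Set.ncard_le_ncard hcard hfin).trans ?_
      classical
      refine le_of_eq_of_le (b := ({1, (c : H ⧸ Z), (y : H ⧸ Z), (c : H ⧸ Z) * y} :
        Finset (H ⧸ Z)).card) ?_ Finset.card_le_four
      rw [← Set.ncard_coe_finset]; simp
    intro h hh
    have hact : ∀ r ∈ R, h * r * h⁻¹ = r ∨ h * r * h⁻¹ = c ^ 2 * r := by
      intro r hr
      have h1 : (h : H ⧸ Z) ∈ derivedSeries (H ⧸ Z) 2 :=
        map_derivedSeries_le_derivedSeries (QuotientGroup.mk' Z) 2 (mem_map_of_mem _ hh)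
      have h2 := mem_centralizer_iff.mp (hle h1) (r : H ⧸ Z) (mem_map_of_mem _ hr)
      have h3 : h * r * h⁻¹ * r⁻¹ ∈ Z := by
        rw [← QuotientGroup.eq_one_iff]
        change (h : H ⧸ Z) * r * (h : H ⧸ Z)⁻¹ * (r : H ⧸ Z)⁻¹ = 1
        rw [← h2]; group
      obtain h3 | h3 := hZ _ h3
      · left; exact mul_inv_eq_one.mp h3
      · right; exact mul_inv_eq_iff_eq_mul.mp h3
    have hgen : ∀ t : H, h * c * h⁻¹ = t * c * t⁻¹ → h * y * h⁻¹ = t * y * t⁻¹ →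
        ∀ r ∈ R, h * r * h⁻¹ = t * r * t⁻¹ := by
      intro t htc hty r hr
      have hpow : ∀ a ∈ zpowers c, h * a * h⁻¹ = t * a * t⁻¹ := by
        rintro _ ⟨k, rfl⟩
        simp only [← conj_zpow, htc]
      obtain ha | ⟨a, ha, rfl⟩ := hR r hr
      · exact hpow _ ha
      · rw [← conj_mul, ← conj_mul, hpow a ha, hty]
    have hc3 : c⁻¹ = c ^ 2 * c := by
      rw [inv_eq_iff_mul_eq_one, ← h4]; group
    have hcy : c * y * c⁻¹ = c ^ 2 * y := by
      have h1 := hinv _ (inv_mem (mem_zpowers c))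
      rw [inv_inv, mul_inv_eq_iff_eq_mul] at h1
      rw [mul_assoc, h1, pow_two, mul_assoc]
    have hyc' : y * c * y⁻¹ = c ^ 2 * c := hyc.trans hc3
    obtain h1 | h1 := hact c hc <;> obtain h2 | h2 := hact y hy
    · exact mem_sup_centralizer_of_conj_eq (one_mem R)
        (hgen 1 (by simpa using h1) (by simpa using h2))
    · exact mem_sup_centralizer_of_conj_eq hc (hgen c (by simpa using h1) (h2.trans hcy.symm))
    · exact mem_sup_centralizer_of_conj_eq hy (hgen y (h1.trans hyc'.symm) (by simpa using h2))
    · refine mem_sup_centralizer_of_conj_eq (mul_mem hc hy)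
        (hgen (c * y) (h1.trans ?_) (h2.trans ?_))
      · rw [← hyc', hyc]
        calc c⁻¹ = c * c⁻¹ * c⁻¹ := by group
          _ = c * (y * c * y⁻¹) * c⁻¹ := by rw [hyc]
          _ = c * y * c * (c * y)⁻¹ := by group
      · rw [← hcy]; group
  · have hcc : ∀ h : H, h * c * h⁻¹ ∈ zpowers c := by
      intro h
      by_contra hn
      have h1 := hout _ (hconj h c hc) hn
      refine h4 ⟨?_, ?_⟩
      · have : (h * c * h⁻¹) ^ 4 = 1 := by rw [pow_mul _ 2 2, h1, hy4]
        simpa [conj_pow, mul_inv_eq_one] using this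
      · intro h2
        rw [conj_pow, h2] at h1
        exact hy2 (by rw [← h1]; group)
    have : (zpowers c).Normal := by
      refine ⟨fun a ha h => ?_⟩
      obtain ⟨k, rfl⟩ := ha
      simp only [← conj_zpow]
      exact zpow_mem (hcc h) k
    have hD : derivedSeries H 1 ≤ centralizer (zpowers c : Set H) :=
      commutator_le_centralizer_of_isCyclic _
    have hfix : ∀ d ∈ derivedSeries H 1, ∀ a ∈ zpowers c, d * a * d⁻¹ = a := fun d hd a ha => by
      rw [mul_inv_eq_iff_eq_mul]
      exact (mem_centralizer_iff.mp (hD hd) a ha).symm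
    have hyD : ∀ d ∈ derivedSeries H 1, ∃ a ∈ zpowers c, d * y * d⁻¹ = a * y := fun d hd => by
      refine (hR _ (hconj d y hy)).resolve_left fun hn => hyn ?_
      have := hfix _ (inv_mem hd) _ hn
      rw [show d⁻¹ * (d * y * d⁻¹) * d⁻¹⁻¹ = y by group] at this
      rwa [this]
    refine le_trans ?_ le_sup_right
    rw [derivedSeries_succ]
    refine commutator_le_centralizer_of_conj_comm fun d hd e he r hr => ?_
    obtain ⟨a, ha, hda⟩ := hyD d hd
    obtain ⟨b, hb, heb⟩ := hyD e he
    obtain hr | ⟨x, hx, rfl⟩ := hR r hr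
    · simp only [hfix d hd r hr, hfix e he r hr]
    · simp only [← conj_mul, hfix d hd, hfix e he, hx, ha, hb, hda, heb]
      have hab : b * a = a * b := by
        obtain ⟨i, rfl⟩ := ha
        obtain ⟨j, rfl⟩ := hb
        exact zpow_mul_comm c j i
      rw [← mul_assoc b a, hab, mul_assoc]

open QuaternionGroup in
/-- The second derived subgroup induces inner automorphisms on every normal subgroup which
embeds in a finite dicyclic group. -/
theorem derivedSeries_two_le_sup_centralizer_of_injective {R : Subgroup H} [R.Normal] {m : ℕ}
    [NeZero m] (φ : R →* QuaternionGroup m) (hφ : Function.Injective φ) :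
    derivedSeries H 2 ≤ R ⊔ centralizer (R : Set H) := by
  let α : Multiplicative (ZMod (2 * m)) →* QuaternionGroup m :=
    { toFun := fun i => a i.toAdd
      map_one' := rfl
      map_mul' := fun i j => rfl }
  let C : Subgroup R := α.range.comap φ
  have hC : IsCyclic C := by
    have : IsCyclic α.range := isCyclic_of_surjective _ α.rangeRestrict_surjective
    exact isCyclic_of_injective (φ.subgroupComap α.range) fun x y h =>
      Subtype.ext (hφ (congrArg Subtype.val h))
  have hmem : ∀ r : R, r ∈ C ↔ ∃ i, φ r = a i :=
    fun r => ⟨fun ⟨i, hi⟩ => ⟨i.toAdd, hi.symm⟩, fun ⟨i, hi⟩ => ⟨.ofAdd i, hi.symm⟩⟩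
  by_cases htop : ∀ r, r ∈ C
  · have : IsCyclic R := isCyclic_of_injective ((MonoidHom.id R).codRestrict C htop)
      fun x y h => congrArg Subtype.val h
    exact ((derivedSeries_antitone H one_le_two).trans
      (commutator_le_centralizer_of_isCyclic R)).trans le_sup_right
  push Not at htop
  obtain ⟨y, hy⟩ := htop
  obtain ⟨⟨c, hcC⟩, hgen⟩ := hC.exists_generator
  have hC' : ∀ r : R, r ∈ C ↔ (r : H) ∈ zpowers (c : H) := by
    refine fun r => ⟨fun hr => ?_, fun ⟨k, hk⟩ => ?_⟩
    · obtain ⟨k, hk⟩ := hgen ⟨r, hr⟩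
      exact ⟨k, congrArg (fun x : C => ((x : R) : H)) hk⟩
    · rw [show r = c ^ k from Subtype.ext hk.symm]
      exact zpow_mem hcC k
  obtain ⟨i, hi⟩ : ∃ i, φ y = xa i := by
    cases h : φ y with
    | a i => exact absurd ((hmem y).mpr ⟨i, h⟩) hy
    | xa i => exact ⟨i, rfl⟩
  refine derivedSeries_two_le_sup_centralizer_of_dicyclic c.2 y.2 ?_ ?_
    (fun h => hy ((hC' y).mpr h)) ?_
  · intro r hr
    cases h : φ ⟨r, hr⟩ with
    | a j => exact Or.inl ((hC' ⟨r, hr⟩).mp ((hmem _).mpr ⟨j, h⟩))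
    | xa j =>
      refine Or.inr ⟨r * (y : H)⁻¹, (hC' (⟨r, hr⟩ * y⁻¹)).mp ((hmem _).mpr ?_), by group⟩
      rw [map_mul, map_inv, h, hi]
      exact ⟨_, rfl⟩
  · obtain ⟨j, hj⟩ := (hmem c).mp hcC
    have : y * c * y⁻¹ = c⁻¹ := hφ (by
      rw [map_mul, map_mul, map_inv, map_inv, hi, hj, mul_inv_eq_iff_eq_mul, eq_inv_mul_iff_mul_eq]
      simp)
    exact congrArg Subtype.val this
  · intro h
    have h2 : y ^ 2 = 1 := Subtype.ext h
    have h3 := congrArg φ h2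
    rw [map_pow, hi, map_one, pow_two, xa_mul_xa, one_def, a.injEq, add_sub_cancel_right] at h3
    have := (ZMod.natCast_eq_zero_iff m (2 * m)).mp h3
    have := Nat.le_of_dvd (NeZero.pos m) this
    have := NeZero.pos m
    omega

end Quaternion

section Sylow

open Subgroup

variable {G : Type*} [Group G]

theorem largestNormalPSubgroup_quotient_eq_bot (p : ℕ) [Fact p.Prime] :
    largestNormalPSubgroup (G ⧸ largestNormalPSubgroup G p) p = ⊥ := by
  set N := largestNormalPSubgroup G p
  set M := largestNormalPSubgroup (G ⧸ N) p
  have h : IsPGroup p (M.comap (QuotientGroup.mk' N)) :=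
    (isPGroup_largestNormalPSubgroup p).comap_of_ker_isPGroup _ (by
      rw [QuotientGroup.ker_mk']
      exact isPGroup_largestNormalPSubgroup p)
  have hle := h.le_largestNormalPSubgroup
  rw [eq_bot_iff, ← map_comap_eq_self_of_surjective (QuotientGroup.mk'_surjective N) M,
    map_le_iff_le_comap]
  exact hle.trans (QuotientGroup.ker_mk' N).ge

/-- A normal `q`-subgroup of the quotient of `G` by a normal `p`-subgroup, `p ≠ q`, embeds in
every Sylow `q`-subgroup of `G`. -/
theorem exists_injective_to_sylow [Finite G] {p q : ℕ} [Fact p.Prime] [Fact q.Prime] (hpq : q ≠ p)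
    {N : Subgroup G} [N.Normal] (hN : IsPGroup p N) {M : Subgroup (G ⧸ N)} [M.Normal]
    (hM : IsPGroup q M) (S : Sylow q G) : ∃ φ : M →* S, Function.Injective φ := by
  let f : S →* G ⧸ N := (QuotientGroup.mk' N).domRestrict S.toSubgroup
  have hf : Function.Injective f := by
    rw [injective_iff_map_eq_one]
    intro s hs
    have h1 : (s : G) ∈ N := (QuotientGroup.eq_one_iff _).mp hs
    have h2 := IsPGroup.disjoint_of_ne q p hpq _ _ S.isPGroup' hN
    exact Subtype.ext (disjoint_def.mp h2 s.2 h1)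
  have hle : M ≤ f.range := by
    refine (hM.le_sylow_of_normal (S.mapSurjective (QuotientGroup.mk'_surjective N))).trans ?_
    rintro _ ⟨s, hs, rfl⟩
    exact ⟨⟨s, hs⟩, rfl⟩
  exact ⟨(MonoidHom.ofInjective hf).symm.toMonoidHom.comp (inclusion hle),
    (MonoidHom.ofInjective hf).symm.injective.comp (inclusion_injective hle)⟩

end Sylow

section FittingHeight

open Subgroup

variable {G : Type*} [Group G]

theorem QuaternionGroup.not_isPGroup_of_ne_two {m : ℕ} [NeZero m] {q : ℕ} [Fact q.Prime]
    (hq : q ≠ 2) :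
    ¬ IsPGroup q (QuaternionGroup m) := by
  intro h
  obtain ⟨n, hn⟩ := IsPGroup.iff_card.mp h
  have h2 : 2 ∣ q ^ n := by
    rw [← hn, Nat.card_eq_fintype_card, QuaternionGroup.card]
    exact ⟨2 * m, by ring⟩
  exact hq ((Nat.prime_dvd_prime_iff_eq Nat.prime_two Fact.out).mp
    (Nat.prime_two.dvd_of_dvd_pow h2)).symm

/-- If all Sylow `q`-subgroups of a finite soluble group `G`, `q ≠ p`, are cyclic or generalized
quaternion, then the second derived subgroup of `G / O_p(G)` is nilpotent. -/
theorem isNilpotent_derivedSeries_two_quotient [Finite G] [Group.IsSolvable G]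
    (p : ℕ) [Fact p.Prime]
    (hSyl : ∀ q : ℕ, q.Prime → q ≠ p →
      ∀ S : Sylow q G, IsCyclic ↥S.toSubgroup ∨ IsGeneralizedQuaternion ↥S.toSubgroup) :
    Group.IsNilpotent (derivedSeries (G ⧸ largestNormalPSubgroup G p) 2) := by
  set N := largestNormalPSubgroup G p
  have hR : ∀ q : ℕ, q.Prime → derivedSeries (G ⧸ N) 2 ≤
      largestNormalPSubgroup (G ⧸ N) q ⊔ centralizer (largestNormalPSubgroup (G ⧸ N) q) ∧
      (q ≠ 2 → derivedSeries (G ⧸ N) 2 ≤ centralizer (largestNormalPSubgroup (G ⧸ N) q)) := by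
    intro q hq
    have := Fact.mk hq
    have hcyc : IsCyclic (largestNormalPSubgroup (G ⧸ N) q) →
        derivedSeries (G ⧸ N) 2 ≤ centralizer (largestNormalPSubgroup (G ⧸ N) q) := fun _ =>
      (derivedSeries_antitone _ one_le_two).trans (commutator_le_centralizer_of_isCyclic _)
    suffices h : IsCyclic (largestNormalPSubgroup (G ⧸ N) q) ∨ q = 2 ∧
        derivedSeries (G ⧸ N) 2 ≤
          largestNormalPSubgroup (G ⧸ N) q ⊔ centralizer (largestNormalPSubgroup (G ⧸ N) q) by
      obtain h | ⟨h2, h⟩ := h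
      · exact ⟨(hcyc h).trans le_sup_right, fun _ => hcyc h⟩
      · exact ⟨h, fun hq2 => absurd h2 hq2⟩
    by_cases hqp : q = p
    · left
      subst hqp
      rw [largestNormalPSubgroup_quotient_eq_bot]
      infer_instance
    · let S : Sylow q G := default
      obtain ⟨φ, hφ⟩ := exists_injective_to_sylow hqp (isPGroup_largestNormalPSubgroup p)
        (isPGroup_largestNormalPSubgroup (H := G ⧸ N) q) S
      obtain h | ⟨n, -, ⟨e⟩⟩ := hSyl q hq hqp S
      · exact Or.inl (isCyclic_of_injective φ hφ)
      · refine Or.inr ⟨?_, derivedSeries_two_le_sup_centralizer_of_injective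
          (e.toMonoidHom.comp φ) (e.injective.comp hφ)⟩
        by_contra hq2
        exact QuaternionGroup.not_isPGroup_of_ne_two hq2 (S.isPGroup'.of_equiv e)
  have hle : derivedSeries (G ⧸ N) 2 ≤ fittingSubgroup (G ⧸ N) := by
    intro h hh
    have := Fact.mk Nat.prime_two
    have : Group.IsNilpotent (largestNormalPSubgroup (G ⧸ N) 2) :=
      (isPGroup_largestNormalPSubgroup (H := G ⧸ N) 2).isNilpotent
    obtain ⟨t, ht, s, hs, rfl⟩ := mem_sup_of_normal_left.mp ((hR 2 Nat.prime_two).1 hh)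
    refine mul_mem (le_fittingSubgroup _ ht) (centralizer_fittingSubgroup_le ?_)
    suffices hs : fittingSubgroup (G ⧸ N) ≤ centralizer {s} from
      mem_centralizer_iff.mpr fun x hx => (mem_centralizer_singleton_iff.mp (hs hx))
    refine iSup_le fun q x hx => mem_centralizer_singleton_iff.mpr ?_
    have hq := Nat.prime_of_mem_primeFactors q.2
    by_cases hq2 : (q : ℕ) = 2
    · exact mem_centralizer_iff.mp hs x (hq2 ▸ hx)
    · have h1 : Commute x (t * s) := mem_centralizer_iff.mp ((hR q hq).2 hq2 hh) x hx
      have h2 : Commute x t := commute_of_mem_largestNormalPSubgroup hq Nat.prime_two hq2 hx ht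
      simpa using (h2.inv_right.mul_right h1).eq
  exact Subgroup.isNilpotent_of_ker_le_center (inclusion hle)
    (by rw [(MonoidHom.ker_eq_bot_iff _).mpr (inclusion_injective hle)]; exact bot_le)

theorem isNilpotentQuotient_of_hom {A B : Subgroup G} {X : Type*} [Group X] [Group.IsNilpotent X]
    (ψ : B →* X) (hψ : ψ.ker = A.subgroupOf B) : IsNilpotentQuotient A B := by
  have : (A.subgroupOf B).Normal := hψ ▸ inferInstance
  refine ⟨this, ?_⟩
  refine Subgroup.isNilpotent_of_ker_le_center (QuotientGroup.lift (A.subgroupOf B) ψ hψ.ge) ?_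
  rw [QuotientGroup.ker_lift, hψ, QuotientGroup.map_mk'_self]
  exact bot_le

theorem isNilpotentQuotient_of_commutator_le {A B : Subgroup G} (hAB : ⁅B, B⁆ ≤ A) :
    IsNilpotentQuotient A B := by
  have h : commutator B ≤ A.subgroupOf B := by
    rw [subgroupOf, ← map_le_iff_le_comap, map_subtype_commutator]
    exact hAB
  have hn : (A.subgroupOf B).Normal := Normal.of_commutator_le _ h
  refine ⟨hn, ?_⟩
  have hc := (Normal.quotient_commutative_iff_commutator_le (N := A.subgroupOf B)).mpr h
  exact @CommGroup.isNilpotent _ { (inferInstance : Group (B ⧸ A.subgroupOf B)) with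
    mul_comm := hc.is_comm.comm }

end FittingHeight

/-- Lemma: a finite soluble group whose Sylow q-subgroups, for all primes q ≠ p, are cyclic
or generalized quaternion has Fitting height at most 4. -/
theorem fitting_height_le_four {G : Type*} [Group G] [Finite G] (hsol : IsSolvable G)
    (p : ℕ) (hp : p.Prime)
    (hSyl : ∀ q : ℕ, q.Prime → q ≠ p →
      ∀ S : Sylow q G, IsCyclic ↥S.toSubgroup ∨ IsGeneralizedQuaternion ↥S.toSubgroup) :
    ∃ f : Fin 5 → Subgroup G, f 0 = ⊥ ∧ f 4 = ⊤ ∧ (∀ i, (f i).Normal) ∧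
      ∀ i : Fin 4, f i.castSucc ≤ f i.succ ∧ IsNilpotentQuotient (f i.castSucc) (f i.succ) := by
  have := Fact.mk hp
  have : Group.IsSolvable G := hsol
  let N := largestNormalPSubgroup G p
  let D : ℕ → Subgroup G := fun k => (derivedSeries (G ⧸ N) k).comap (QuotientGroup.mk' N)
  have hND : N ≤ D 2 := (QuotientGroup.ker_mk' N).ge.trans (Subgroup.ker_le_comap _ _)
  have hD : ∀ k, D (k + 1) ≤ D k ∧ IsNilpotentQuotient (D (k + 1)) (D k) := fun k =>
    ⟨Subgroup.comap_mono (derivedSeries_antitone _ k.le_succ),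
      isNilpotentQuotient_of_commutator_le (Subgroup.map_le_iff_le_comap.mp (by
        rw [Subgroup.map_commutator, derivedSeries_succ]
        exact Subgroup.commutator_mono (Subgroup.map_comap_le _ _) (Subgroup.map_comap_le _ _)))⟩
  have hN : Group.IsNilpotent N := (isPGroup_largestNormalPSubgroup p).isNilpotent
  have h2 := isNilpotent_derivedSeries_two_quotient p hSyl
  have hbot : IsNilpotentQuotient ⊥ N := isNilpotentQuotient_of_hom (MonoidHom.id N) (by simp)
  have hN2 : IsNilpotentQuotient N (D 2) :=
    isNilpotentQuotient_of_hom ((QuotientGroup.mk' N).subgroupComap (derivedSeries (G ⧸ N) 2)) (by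
      ext x
      rw [MonoidHom.mem_ker, Subgroup.mem_subgroupOf, Subtype.ext_iff]
      exact QuotientGroup.eq_one_iff _)
  refine ⟨![⊥, N, D 2, D 1, ⊤], rfl, rfl, ?_, ?_⟩
  · intro i
    fin_cases i
    · exact (inferInstance : (⊥ : Subgroup G).Normal)
    · exact (inferInstance : N.Normal)
    · exact (inferInstance : (D 2).Normal)
    · exact (inferInstance : (D 1).Normal)
    · exact (inferInstance : (⊤ : Subgroup G).Normal)
  · have h0 : D 0 = ⊤ := by simp [D]
    intro i
    fin_cases i
    · exact ⟨bot_le, hbot⟩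
    · exact ⟨hND, hN2⟩
    · exact hD 1
    · exact h0 ▸ hD 0
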